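/- arXiv:0901.1732 — 5 statements merged into one kernel-verified Lean document; each statement's English description precedes it below -/
import Mathlib

section
/- Fix finite alphabets 𝒳 and 𝒴, a probability mass function Q on 𝒳, a positive integer m, a sequence y ∈ 𝒴^m, and a sequence x₀ ∈ 𝒳^m. Let T = {x ∈ 𝒳^m : P̂_{xy} = P̂_{x₀y}} be the set of sequences having the same empirical joint distribution with y as x₀. Then the probability of T under the i.i.d. product measure Q^m satisfies Q^m(T) ≤ exp(−m · Î(x₀; y)). -/
open MeasureTheory

/-- Empirical joint distribution: `P̂_{xy}(a,b) = (1/m)·|{i : x i = a ∧ y i = b}|`. -/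
noncomputable def empJoint {X Y : Type*} [Fintype X] [Fintype Y] [DecidableEq X] [DecidableEq Y]
    (m : ℕ) (x : Fin m → X) (y : Fin m → Y) (a : X) (b : Y) : ℝ :=
  ((Finset.univ.filter fun i => x i = a ∧ y i = b).card : ℝ) / m

/-- Empirical marginal of the first sequence. -/
noncomputable def empMargX {X : Type*} [Fintype X] [DecidableEq X]
    (m : ℕ) (x : Fin m → X) (a : X) : ℝ :=
  ((Finset.univ.filter fun i => x i = a).card : ℝ) / m

/-- Empirical marginal of the second sequence. -/
noncomputable def empMargY {Y : Type*} [Fintype Y] [DecidableEq Y]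
    (m : ℕ) (y : Fin m → Y) (b : Y) : ℝ :=
  ((Finset.univ.filter fun i => y i = b).card : ℝ) / m

/-- Empirical mutual information (natural logarithm), summing over pairs with
`P̂_{xy}(a,b) > 0`. -/
noncomputable def empMI {X Y : Type*} [Fintype X] [Fintype Y] [DecidableEq X] [DecidableEq Y]
    (m : ℕ) (x : Fin m → X) (y : Fin m → Y) : ℝ :=
  ∑ a : X, ∑ b : Y,
    if 0 < empJoint m x y a b then
      empJoint m x y a b *
        Real.log (empJoint m x y a b / (empMargX m x a * empMargY m y b))
    else 0

theorem empMargX_apply_pos {X : Type*} [Fintype X] [DecidableEq X] {m : ℕ}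
    (hm : 0 < m) (x : Fin m → X) (i : Fin m) :
    0 < empMargX m x (x i) :=
  div_pos (Nat.cast_pos.2 (Finset.card_pos.2 ⟨i, by simp⟩)) (Nat.cast_pos.2 hm)

theorem empMargY_apply_pos {Y : Type*} [Fintype Y] [DecidableEq Y] {m : ℕ}
    (hm : 0 < m) (y : Fin m → Y) (i : Fin m) :
    0 < empMargY m y (y i) :=
  div_pos (Nat.cast_pos.2 (Finset.card_pos.2 ⟨i, by simp⟩)) (Nat.cast_pos.2 hm)

section EmpiricalTypes

variable {X Y : Type*} [Fintype X] [Fintype Y] [DecidableEq X] [DecidableEq Y] {m : ℕ}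

theorem sum_empJoint_mul (x : Fin m → X) (y : Fin m → Y) (f : X → Y → ℝ) :
    ∑ a, ∑ b, empJoint m x y a b * f a b = (∑ i, f (x i) (y i)) / m := by
  have h (i : Fin m) :
      f (x i) (y i) = ∑ a, ∑ b, (if x i = a ∧ y i = b then (1 : ℝ) else 0) * f a b := by
    simp [ite_and]
  simp only [h, empJoint, Finset.natCast_card_filter]
  simp_rw [div_mul_eq_mul_div, Finset.sum_mul, Finset.sum_div]
  rw [Finset.sum_comm (s := (Finset.univ : Finset (Fin m)))]
  exact Finset.sum_congr rfl fun a _ => Finset.sum_comm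

theorem empMargX_eq_sum_empJoint (x : Fin m → X) (y : Fin m → Y) (a : X) :
    empMargX m x a = ∑ b, empJoint m x y a b := by
  simp_rw [empMargX, empJoint, ← Finset.sum_div, ← Nat.cast_sum, ← Finset.filter_filter]
  rw [← Finset.card_eq_sum_card_fiberwise fun _ _ => Finset.mem_coe.2 (Finset.mem_univ _)]

theorem empMargY_eq_sum_empJoint (x : Fin m → X) (y : Fin m → Y) (b : Y) :
    empMargY m y b = ∑ a, empJoint m x y a b := by
  simp_rw [empMargY, empJoint, ← Finset.sum_div, ← Nat.cast_sum, and_comm (b := y _ = b),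
    ← Finset.filter_filter]
  rw [← Finset.card_eq_sum_card_fiberwise fun _ _ => Finset.mem_coe.2 (Finset.mem_univ _)]

theorem empJoint_nonneg (x : Fin m → X) (y : Fin m → Y) (a : X) (b : Y) :
    0 ≤ empJoint m x y a b := by
  unfold empJoint; positivity

theorem empJoint_apply_pos (hm : 0 < m) (x : Fin m → X) (y : Fin m → Y) (i : Fin m) :
    0 < empJoint m x y (x i) (y i) :=
  div_pos (Nat.cast_pos.2 (Finset.card_pos.2 ⟨i, by simp⟩)) (Nat.cast_pos.2 hm)

/-- `m` times the empirical mutual information is the sum of the information densities. -/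
theorem mul_empMI (hm : 0 < m) (x : Fin m → X) (y : Fin m → Y) :
    m * empMI m x y = ∑ i, Real.log (empJoint m x y (x i) (y i) /
      (empMargX m x (x i) * empMargY m y (y i))) := by
  have hm' : (m : ℝ) ≠ 0 := by positivity
  have h : empMI m x y = ∑ a, ∑ b, empJoint m x y a b *
      Real.log (empJoint m x y a b / (empMargX m x a * empMargY m y b)) := by
    refine Finset.sum_congr rfl fun a _ => Finset.sum_congr rfl fun b _ => ?_
    split_ifs with h
    · rfl
    · simp [le_antisymm (not_lt.1 h) (empJoint_nonneg x y a b)]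
  rw [h, sum_empJoint_mul x y fun a b =>
    Real.log (empJoint m x y a b / (empMargX m x a * empMargY m y b)), mul_div_cancel₀ _ hm']

/-- The empirical distribution maximizes the likelihood of a sequence. -/
theorem prod_le_prod_empMargX (hm : 0 < m) (x : Fin m → X) (q : X → ℝ) (hq : ∀ a, 0 ≤ q a)
    (hq1 : ∑ a, q a ≤ 1) : ∏ i, q (x i) ≤ ∏ i, empMargX m x (x i) := by
  have hm' : (0 : ℝ) < m := by positivity
  have hsum : ∑ i, q (x i) / empMargX m x (x i) ≤ m := by
    rw [← div_le_one hm', ← sum_empJoint_mul x x fun a _ => q a / empMargX m x a]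
    refine le_trans (Finset.sum_le_sum fun a _ => ?_) hq1
    rw [← Finset.sum_mul, ← empMargX_eq_sum_empJoint]
    by_cases h : empMargX m x a = 0
    · simpa [h] using hq a
    · rw [mul_div_cancel₀ _ h]
  have hprod : ∏ i, q (x i) / empMargX m x (x i) ≤ 1 := by
    calc ∏ i, q (x i) / empMargX m x (x i)
        ≤ ∏ i, Real.exp (q (x i) / empMargX m x (x i) - 1) :=
          Finset.prod_le_prod
            (fun i _ => div_nonneg (hq _) (empMargX_apply_pos hm x i).le)
            fun i _ => by linarith [Real.add_one_le_exp (q (x i) / empMargX m x (x i) - 1)]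
      _ = Real.exp (∑ i, q (x i) / empMargX m x (x i) - m) := by
          rw [← Real.exp_sum, Finset.sum_sub_distrib]; simp
      _ ≤ 1 := Real.exp_le_one_iff.2 (by linarith)
  rwa [Finset.prod_div_distrib,
    div_le_one (Finset.prod_pos fun i _ => empMargX_apply_pos hm x i)] at hprod

theorem prod_le_exp_neg_empMI_mul (hm : 0 < m) (x : Fin m → X) (y : Fin m → Y) (q : X → ℝ)
    (hq : ∀ a, 0 ≤ q a) (hq1 : ∑ a, q a ≤ 1) :
    ∏ i, q (x i) ≤ Real.exp (-(m * empMI m x y)) *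
      ∏ i, empJoint m x y (x i) (y i) / empMargY m y (y i) := by
  refine (prod_le_prod_empMargX hm x q hq hq1).trans_eq ?_
  rw [mul_empMI hm, ← Finset.sum_neg_distrib, Real.exp_sum, ← Finset.prod_mul_distrib]
  refine Finset.prod_congr rfl fun i _ => ?_
  have hj := empJoint_apply_pos hm x y i
  have hx := empMargX_apply_pos hm x i
  have hy := empMargY_apply_pos hm y i
  rw [Real.exp_neg, Real.exp_log (by positivity)]
  field_simp

theorem empMargX_congr {x x' : Fin m → X} (y : Fin m → Y)
    (h : empJoint m x y = empJoint m x' y) : empMargX m x = empMargX m x' := by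
  ext a
  rw [empMargX_eq_sum_empJoint x y, empMargX_eq_sum_empJoint x' y, h]

theorem empMI_congr {x x' : Fin m → X} (y : Fin m → Y)
    (h : empJoint m x y = empJoint m x' y) : empMI m x y = empMI m x' y := by
  simp only [empMI, h, empMargX_congr y h]

/-- The conditional empirical law of the first sequence given `y` defines a product law of total
mass one. -/
theorem sum_prod_empJoint_div_empMargY (hm : 0 < m) (x₀ : Fin m → X) (y : Fin m → Y) :
    ∑ x : Fin m → X, ∏ i, empJoint m x₀ y (x i) (y i) / empMargY m y (y i) = 1 := by
  rw [← Fintype.prod_sum fun i a => empJoint m x₀ y a (y i) / empMargY m y (y i)]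
  refine Finset.prod_eq_one fun i _ => ?_
  rw [← Finset.sum_div, ← empMargY_eq_sum_empJoint, div_self (empMargY_apply_pos hm y i).ne']

end EmpiricalTypes

/-- The probability, under the i.i.d. product measure `Q^m`, of the set of sequences having
the same empirical joint distribution with `y` as `x₀` is at most `exp(−m·Î(x₀;y))`. -/
theorem prob_of_conditional_type {X Y : Type*} [Fintype X] [Fintype Y]
    [DecidableEq X] [DecidableEq Y] [MeasurableSpace X] [MeasurableSingletonClass X]
    (Q : PMF X) (m : ℕ) (hm : 0 < m) (y : Fin m → Y) (x₀ : Fin m → X) :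
    (Measure.pi fun _ : Fin m => Q.toMeasure)
        {x : Fin m → X | ∀ a b, empJoint m x y a b = empJoint m x₀ y a b}
      ≤ ENNReal.ofReal (Real.exp (-(m * empMI m x₀ y))) := by
  classical
  set q : X → ℝ := fun a => (Q a).toReal
  have hq (a : X) : 0 ≤ q a := ENNReal.toReal_nonneg
  have hq1 : ∑ a, q a ≤ 1 := by
    rw [← ENNReal.toReal_sum fun a _ => Q.apply_ne_top a, ← tsum_fintype (L := .unconditional X),
      Q.tsum_coe, ENNReal.toReal_one]
  set T : Finset (Fin m → X) :=
    Finset.univ.filter fun x => ∀ a b, empJoint m x y a b = empJoint m x₀ y a b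
  have hT : {x : Fin m → X | ∀ a b, empJoint m x y a b = empJoint m x₀ y a b} = ↑T := by
    simp [T]
  have hsingle (x : Fin m → X) :
      (Measure.pi fun _ : Fin m => Q.toMeasure) {x} = ENNReal.ofReal (∏ i, q (x i)) := by
    rw [Measure.pi_singleton, ENNReal.ofReal_prod_of_nonneg fun i _ => hq _]
    refine Finset.prod_congr rfl fun i _ => ?_
    rw [Q.toMeasure_apply_singleton _ (measurableSet_singleton _),
      ENNReal.ofReal_toReal (Q.apply_ne_top _)]
  rw [hT, ← sum_measure_singleton]
  simp_rw [hsingle]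
  rw [← ENNReal.ofReal_sum_of_nonneg fun x _ => Finset.prod_nonneg fun i _ => hq _]
  refine ENNReal.ofReal_le_ofReal ?_
  set W : (Fin m → X) → ℝ := fun x =>
    ∏ i, empJoint m x₀ y (x i) (y i) / empMargY m y (y i)
  have hW (x : Fin m → X) : 0 ≤ W x := Finset.prod_nonneg fun i _ =>
    div_nonneg (empJoint_nonneg _ _ _ _) (empMargY_apply_pos hm y i).le
  calc ∑ x ∈ T, ∏ i, q (x i)
      ≤ ∑ x ∈ T, Real.exp (-(m * empMI m x₀ y)) * W x := by
        refine Finset.sum_le_sum fun x hx => ?_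
        have h : empJoint m x y = empJoint m x₀ y :=
          funext₂ (Finset.mem_filter.1 hx).2
        simpa only [h, empMI_congr y h] using prod_le_exp_neg_empMI_mul hm x y q hq hq1
    _ ≤ ∑ x, Real.exp (-(m * empMI m x₀ y)) * W x :=
        Finset.sum_le_univ_sum_of_nonneg fun x => mul_nonneg (Real.exp_pos _).le (hW x)
    _ = Real.exp (-(m * empMI m x₀ y)) := by
        rw [← Finset.mul_sum, sum_prod_empJoint_div_empMargY hm, mul_one]
end

section
/- (Lemma 4 of the full paper.) Let m ≥ 2, let P > 0, let y ∈ ℝ^m be a fixed nonzero vector, and let X = (X₁,…,X_m) have i.i.d. Gaussian coordinates with mean 0 and variance P. Then for every t > 0, Pr( −(1/2)·log(1 − ρ̂(X,y)²) ≥ t ) ≤ 2·exp(−(m−1)·t), where the event is interpreted to include the case X = 0 excluded (X ≠ 0 almost surely). -/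
open MeasureTheory ProbabilityTheory

/-- Empirical correlation factor `ρ̂(x,y) = ⟨x,y⟩/(‖x‖·‖y‖)`, with the convention
`ρ̂(x,y) = 0` when `x = 0` or `y = 0`. -/
noncomputable def rhoHat {m : ℕ} (x y : Fin m → ℝ) : ℝ :=
  if x = 0 ∨ y = 0 then 0
  else (∑ i, x i * y i) / (Real.sqrt (∑ i, x i ^ 2) * Real.sqrt (∑ i, y i ^ 2))

/-- Two-sided Chernoff bound for the standard Gaussian. -/
lemma gaussianReal_abs_ge_le {a : ℝ} (ha : 0 ≤ a) :
    gaussianReal 0 1 {u : ℝ | a ≤ |u|} ≤ ENNReal.ofReal (2 * Real.exp (-a ^ 2 / 2)) := by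
  have h1 : HasSubgaussianMGF (fun u : ℝ ↦ u) 1 (gaussianReal 0 1) :=
    { integrable_exp_mul := integrable_exp_mul_gaussianReal
      mgf_le := fun t ↦ by rw [mgf_fun_id_gaussianReal]; simp }
  have h_pos := h1.measure_ge_le ha
  have h_neg := h1.neg.measure_ge_le ha
  rw [← ENNReal.ofReal_toReal (measure_ne_top (gaussianReal 0 1) {u : ℝ | a ≤ |u|})]
  apply ENNReal.ofReal_le_ofReal
  have hset : {u : ℝ | a ≤ |u|} = {u : ℝ | a ≤ u} ∪ {u : ℝ | a ≤ -u} := by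
    ext u; exact le_abs (α := ℝ)
  have h_union := measureReal_union_le (μ := gaussianReal 0 1) {u : ℝ | a ≤ u} {u : ℝ | a ≤ -u}
  rw [← hset] at h_union
  simp only [NNReal.coe_one, mul_one, Pi.neg_apply] at h_pos h_neg
  change (gaussianReal 0 1).real _ ≤ _
  linarith

lemma integrable_exp_neg_mul_sq_gaussianReal {k : ℝ} (hk : 0 ≤ k) :
    Integrable (fun x : ℝ ↦ Real.exp (-(k * x ^ 2) / 2)) (gaussianReal 0 1) := by
  refine Integrable.of_bound (by fun_prop) 1 (ae_of_all _ fun x ↦ ?_)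
  rw [Real.norm_of_nonneg (Real.exp_nonneg _), Real.exp_le_one_iff]
  have := mul_nonneg hk (sq_nonneg x)
  linarith

lemma integral_exp_neg_mul_sq_gaussianReal {k : ℝ} (hk : 0 ≤ k) :
    ∫ x, Real.exp (-(k * x ^ 2) / 2) ∂(gaussianReal 0 1) = (√(1 + k))⁻¹ := by
  rw [integral_gaussianReal_eq_integral_smul one_ne_zero]
  have h (x : ℝ) : gaussianPDFReal 0 1 x • Real.exp (-(k * x ^ 2) / 2)
      = (√(2 * Real.pi))⁻¹ * Real.exp (-((1 + k) / 2) * x ^ 2) := by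
    simp only [gaussianPDFReal, NNReal.coe_one, mul_one, sub_zero, smul_eq_mul, mul_assoc,
      ← Real.exp_add]
    ring_nf
  simp_rw [h]
  rw [integral_const_mul, integral_gaussian, ← Real.sqrt_inv, ← Real.sqrt_inv,
    ← Real.sqrt_mul (by positivity)]
  congr 1
  have := Real.pi_pos
  field_simp

/-- The Gaussian measure of a double cone around the first coordinate axis. -/
lemma pi_gaussianReal_cone_le (n : ℕ) {k : ℝ} (hk : 0 ≤ k) :
    (Measure.pi fun _ : Fin (n + 1) ↦ gaussianReal 0 1)
        {x | k * ∑ i : Fin n, x i.succ ^ 2 ≤ x 0 ^ 2}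
      ≤ ENNReal.ofReal (2 * (√(1 + k))⁻¹ ^ n) := by
  have hmp := (measurePreserving_piFinSuccAbove
    (fun _ : Fin (n + 1) ↦ gaussianReal 0 1) 0)
  set C : Set (ℝ × (Fin n → ℝ)) := {p | k * ∑ i, p.2 i ^ 2 ≤ p.1 ^ 2}
  have hC : MeasurableSet C := measurableSet_le (by fun_prop) (by fun_prop)
  have hpre : {x : Fin (n + 1) → ℝ | k * ∑ i : Fin n, x i.succ ^ 2 ≤ x 0 ^ 2}
      = MeasurableEquiv.piFinSuccAbove (fun _ : Fin (n + 1) ↦ ℝ) 0 ⁻¹' C := rfl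
  rw [hpre, hmp.measure_preimage hC.nullMeasurableSet, Measure.prod_apply_symm hC]
  calc ∫⁻ v, gaussianReal 0 1 ((fun u ↦ (u, v)) ⁻¹' C)
        ∂(Measure.pi fun _ : Fin n ↦ gaussianReal 0 1)
      ≤ ∫⁻ v, ENNReal.ofReal (2 * ∏ i, Real.exp (-(k * v i ^ 2) / 2))
        ∂(Measure.pi fun _ : Fin n ↦ gaussianReal 0 1) := by
        refine lintegral_mono fun v ↦ ?_
        have hs : 0 ≤ k * ∑ i, v i ^ 2 := by positivity
        have hset : (fun u ↦ (u, v)) ⁻¹' C = {u : ℝ | √(k * ∑ i, v i ^ 2) ≤ |u|} := by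
          ext u
          simp only [C, Set.mem_preimage, Set.mem_ofPred_eq]
          rw [Real.sqrt_le_left (abs_nonneg u), sq_abs]
        rw [hset]
        refine (gaussianReal_abs_ge_le (Real.sqrt_nonneg _)).trans_eq ?_
        rw [Real.sq_sqrt hs, ← Real.exp_sum,
          ← Finset.sum_div, Finset.sum_neg_distrib, Finset.mul_sum]
    _ = ENNReal.ofReal (2 * (√(1 + k))⁻¹ ^ n) := by
        rw [← ofReal_integral_eq_lintegral_ofReal
            ((Integrable.fintype_prod fun _ ↦
              integrable_exp_neg_mul_sq_gaussianReal hk).const_mul 2)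
            (ae_of_all _ fun v ↦ by positivity),
          integral_const_mul,
          integral_fintype_prod_eq_pow (fun x : ℝ ↦ Real.exp (-(k * x ^ 2) / 2)),
          integral_exp_neg_mul_sq_gaussianReal hk, Fintype.card_fin]

open scoped RealInnerProductSpace in
/-- The standard Gaussian measure of a double cone around an arbitrary axis `y`. -/
lemma stdGaussian_cone_le (n : ℕ) {k : ℝ} (hk : 0 ≤ k) {y : EuclideanSpace ℝ (Fin (n + 1))}
    (hy : y ≠ 0) :
    stdGaussian (EuclideanSpace ℝ (Fin (n + 1)))
        {z | k * (‖z‖ ^ 2 * ‖y‖ ^ 2 - ⟪z, y⟫ ^ 2) ≤ ⟪z, y⟫ ^ 2}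
      ≤ ENNReal.ofReal (2 * (√(1 + k))⁻¹ ^ n) := by
  have hy' : 0 < ‖y‖ := norm_pos_iff.2 hy
  obtain ⟨b, hb⟩ := Orthonormal.exists_orthonormalBasis_extension_of_card_eq (𝕜 := ℝ)
    (E := EuclideanSpace ℝ (Fin (n + 1))) (ι := Fin (n + 1)) (by simp)
    (v := fun _ ↦ ‖y‖⁻¹ • y) (s := {0})
    ⟨fun i ↦ by simp [norm_smul, hy'.ne'],
      fun i j hij ↦ (hij (Subsingleton.elim i j)).elim⟩
  have hyb : y = ‖y‖ • b 0 := by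
    rw [hb 0 rfl, smul_inv_smul₀ hy'.ne']
  have hinner (x : Fin (n + 1) → ℝ) : ⟪∑ i, x i • b i, y⟫ = ‖y‖ * x 0 := by
    conv_lhs => rw [hyb]
    rw [inner_smul_right, b.orthonormal.inner_left_fintype]
    simp
  have hnorm (x : Fin (n + 1) → ℝ) : ‖∑ i, x i • b i‖ ^ 2 = ∑ i, x i ^ 2 := by
    rw [← real_inner_self_eq_norm_sq, b.orthonormal.inner_sum]
    simp [sq]
  rw [stdGaussian_eq_map_pi_orthonormalBasis b, Measure.map_apply (by fun_prop)
    (measurableSet_le (by fun_prop) (by fun_prop))]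
  refine (measure_mono fun x hx ↦ ?_).trans (pi_gaussianReal_cone_le n hk)
  simp only [Set.mem_preimage, Set.mem_ofPred_eq, hinner, hnorm] at hx ⊢
  rw [Fin.sum_univ_succ] at hx
  have h2 : 0 < ‖y‖ ^ 2 := by positivity
  refine le_of_mul_le_mul_left ?_ h2
  linarith

lemma pi_gaussianReal_eq_map_const_mul {ι : Type*} [Fintype ι] {P : ℝ} (hP : 0 ≤ P) :
    (Measure.pi fun _ : ι ↦ gaussianReal 0 P.toNNReal)
      = (Measure.pi fun _ : ι ↦ gaussianReal 0 1).map (fun x i ↦ √P * x i) := by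
  rw [Measure.pi_map_pi (fun _ ↦ by fun_prop)]
  congr with i : 1
  rw [gaussianReal_map_const_mul]
  congr 1
  · simp
  · ext; simp [Real.sq_sqrt hP, hP]

/-- The correlation-metric event lies in a closed double cone around `y`. -/
lemma mul_sub_inner_sq_le_of_le_log_rhoHat {m : ℕ} {x y : Fin m → ℝ} (hy : y ≠ 0) {t : ℝ}
    (ht : 0 < t) (h : t ≤ -(1 / 2) * Real.log (1 - rhoHat x y ^ 2)) :
    (Real.exp (2 * t) - 1) * ((∑ i, x i ^ 2) * (∑ i, y i ^ 2) - (∑ i, x i * y i) ^ 2)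
      ≤ (∑ i, x i * y i) ^ 2 := by
  by_cases hx : x = 0
  · simp [hx]
  have sum_pos {z : Fin m → ℝ} (hz : z ≠ 0) : 0 < ∑ i, z i ^ 2 := by
    obtain ⟨i, hi⟩ := Function.ne_iff.1 hz
    exact Finset.sum_pos' (fun j _ ↦ sq_nonneg _) ⟨i, Finset.mem_univ i, sq_pos_of_ne_zero hi⟩
  have hX := sum_pos hx
  have hY := sum_pos hy
  have hcs := Finset.sum_mul_sq_le_sq_mul_sq Finset.univ x y
  have hrho : rhoHat x y ^ 2 = (∑ i, x i * y i) ^ 2 / ((∑ i, x i ^ 2) * ∑ i, y i ^ 2) := by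
    rw [rhoHat, if_neg (by tauto), div_pow, mul_pow, Real.sq_sqrt hX.le, Real.sq_sqrt hY.le]
  have hle : rhoHat x y ^ 2 ≤ 1 := by
    rw [hrho]; exact div_le_one_of_le₀ hcs (by positivity)
  have hlog : Real.log (1 - rhoHat x y ^ 2) ≤ -(2 * t) := by linarith
  have hpos : 0 < 1 - rhoHat x y ^ 2 := by
    refine (sub_nonneg.2 hle).lt_of_ne fun h0 ↦ ?_
    rw [← h0, Real.log_zero] at hlog
    linarith
  have hexp := (Real.log_le_iff_le_exp hpos).1 hlog
  rw [Real.exp_neg, hrho, one_sub_div (by positivity), div_le_iff₀ (by positivity),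
    ← div_eq_inv_mul, le_div_iff₀ (Real.exp_pos _)] at hexp
  linarith

/-- Lemma 4 of the full paper: for `X` with i.i.d. `N(0,P)` coordinates and fixed nonzero `y`,
`Pr(−(1/2)·log(1 − ρ̂(X,y)²) ≥ t) ≤ 2·exp(−(m−1)·t)` for every `t > 0`. -/
theorem prob_correlation_metric_large (m : ℕ) (hm : 2 ≤ m) (P : ℝ) (hP : 0 < P)
    (y : Fin m → ℝ) (hy : y ≠ 0) (t : ℝ) (ht : 0 < t) :
    (Measure.pi fun _ : Fin m => gaussianReal 0 P.toNNReal)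
        {x : Fin m → ℝ | t ≤ -(1 / 2) * Real.log (1 - rhoHat x y ^ 2)}
      ≤ ENNReal.ofReal (2 * Real.exp (-((m : ℝ) - 1) * t)) := by
  obtain ⟨n, rfl⟩ : ∃ n, m = n + 1 := ⟨m - 1, by omega⟩
  have hk : 0 ≤ Real.exp (2 * t) - 1 := by
    linarith [Real.add_one_le_exp (2 * t)]
  have hbound := stdGaussian_cone_le n hk (y := WithLp.toLp 2 y) (by simpa using hy)
  rw [← map_pi_eq_stdGaussian, Measure.map_apply (by fun_prop)
    (measurableSet_le (by fun_prop) (by fun_prop))] at hbound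
  calc _ ≤ (Measure.pi fun _ : Fin (n + 1) ↦ gaussianReal 0 P.toNNReal)
        {x | (Real.exp (2 * t) - 1)
            * ((∑ i, x i ^ 2) * (∑ i, y i ^ 2) - (∑ i, x i * y i) ^ 2)
          ≤ (∑ i, x i * y i) ^ 2} :=
        measure_mono (Set.ofPred_subset_ofPred.2 fun _ ↦ mul_sub_inner_sq_le_of_le_log_rhoHat hy ht)
    _ ≤ ENNReal.ofReal (2 * (√(1 + (Real.exp (2 * t) - 1)))⁻¹ ^ n) := by
        rw [pi_gaussianReal_eq_map_const_mul hP.le, Measure.map_apply (by fun_prop)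
          (measurableSet_le (by fun_prop) (by fun_prop))]
        refine (measure_mono fun x hx ↦ ?_).trans hbound
        simp only [Set.mem_preimage, Set.mem_ofPred_eq, mul_pow, mul_assoc, ← Finset.mul_sum,
          Real.sq_sqrt hP.le, EuclideanSpace.real_norm_sq_eq, PiLp.inner_apply, RCLike.inner_apply,
          conj_trivial] at hx ⊢
        simp only [mul_comm (y _)]
        refine le_of_mul_le_mul_left ?_ hP
        linarith
    _ = ENNReal.ofReal (2 * Real.exp (-(((n + 1 : ℕ) : ℝ) - 1) * t)) := by
        rw [add_sub_cancel, two_mul t, Real.exp_add, Real.sqrt_mul_self (Real.exp_nonneg _),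
          ← Real.exp_neg, ← Real.exp_nat_mul]
        congr 3
        push_cast
        ring
end

section
/- (Likely convexity, discrete case; Lemma 5 of the full paper, fixed number of subsets.) Fix finite alphabets 𝒳 and 𝒴, a probability mass function Q on 𝒳, a positive integer L, and reals Δ > 0 and P_A > 0. Then there exists n₀ such that for every n ≥ n₀ and every partition of {1,…,n} into nonempty subsets S₁,…,S_L, there exists a set J ⊆ 𝒳^n with Q^n(J) ≤ P_A such that for every x ∈ 𝒳^n with x ∉ J and every y ∈ 𝒴^n: Σ_{j=1}^{L} (|S_j|/n)·Î(x|_{S_j}; y|_{S_j}) ≥ Î(x; y) − Δ, where x|_{S_j} and y|_{S_j} denote the subsequences of x and y indexed by S_j. -/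
open MeasureTheory

/-- Empirical joint distribution of the subsequences of `x` and `y` indexed by `s`. -/
noncomputable def empJointOn {n : ℕ} {X Y : Type*} [DecidableEq X] [DecidableEq Y]
    (s : Finset (Fin n)) (x : Fin n → X) (y : Fin n → Y) (a : X) (b : Y) : ℝ :=
  ((s.filter fun i => x i = a ∧ y i = b).card : ℝ) / s.card

/-- Empirical marginal of the subsequence of `x` indexed by `s`. -/
noncomputable def empMargXOn {n : ℕ} {X : Type*} [DecidableEq X]
    (s : Finset (Fin n)) (x : Fin n → X) (a : X) : ℝ :=
  ((s.filter fun i => x i = a).card : ℝ) / s.card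

/-- Empirical marginal of the subsequence of `y` indexed by `s`. -/
noncomputable def empMargYOn {n : ℕ} {Y : Type*} [DecidableEq Y]
    (s : Finset (Fin n)) (y : Fin n → Y) (b : Y) : ℝ :=
  ((s.filter fun i => y i = b).card : ℝ) / s.card

/-- Empirical mutual information (natural logarithm) of the subsequences of `x` and `y`
indexed by `s`, summing over pairs with positive empirical probability. -/
noncomputable def empMIOn {n : ℕ} {X Y : Type*} [Fintype X] [Fintype Y]
    [DecidableEq X] [DecidableEq Y]
    (s : Finset (Fin n)) (x : Fin n → X) (y : Fin n → Y) : ℝ :=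
  ∑ a : X, ∑ b : Y,
    if 0 < empJointOn s x y a b then
      empJointOn s x y a b *
        Real.log (empJointOn s x y a b / (empMargXOn s x a * empMargYOn s y b))
    else 0

section

open Finset

theorem sum_mul_log_le {ι X Y : Type*} [Fintype ι] [Fintype X] [Fintype Y]
    (c : ι → X → Y → ℝ) (hc : ∀ j a b, 0 ≤ c j a b) (q : X → ℝ) (hq : ∀ a, 0 ≤ q a)
    (hq1 : ∑ a, q a = 1) (r : ι → X → ℝ) (hr : ∀ j a, r j a = ∑ b, c j a b)
    (t : ι → Y → ℝ) (ht : ∀ j b, t j b = ∑ a, c j a b)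
    (m : ι → ℝ) (hm : ∀ j, m j = ∑ a, r j a)
    (C : X → Y → ℝ) (hC : ∀ a b, C a b = ∑ j, c j a b)
    (R : X → ℝ) (hR : ∀ a, R a = ∑ b, C a b)
    (T : Y → ℝ) (hT : ∀ b, T b = ∑ j, t j b)
    (N : ℝ) (hN : N = ∑ j, m j) (hm0 : ∀ j, 0 < m j)
    (hsupp : ∀ j a, q a = 0 → r j a = 0) :
    ∑ a, ∑ b, C a b * Real.log (C a b * N / (R a * T b)) ≤
      ∑ j, ∑ a, ∑ b, c j a b * Real.log (c j a b * m j / (r j a * t j b)) +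
      ∑ j, ∑ a, (r j a - m j * q a) ^ 2 / (m j * q a) := by
  have hr0 : ∀ j a, 0 ≤ r j a := fun j a => by rw [hr]; exact sum_nonneg fun b _ => hc j a b
  have ht0 : ∀ j a, 0 ≤ t j a := fun j a => by rw [ht]; exact sum_nonneg fun b _ => hc j _ _
  have hC0 : ∀ a b, 0 ≤ C a b := fun a b => by rw [hC]; exact sum_nonneg fun j _ => hc j a b
  have hR0 : ∀ a, 0 ≤ R a := fun a => by rw [hR]; exact sum_nonneg fun b _ => hC0 a b
  have hT0 : ∀ b, 0 ≤ T b := fun b => by rw [hT]; exact sum_nonneg fun j _ => ht0 j b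
  have hN0 : 0 ≤ N := by rw [hN]; exact sum_nonneg fun j _ => (hm0 j).le
  have hcC : ∀ j a b, c j a b ≤ C a b := fun j a b => by
    rw [hC]; exact single_le_sum (f := fun j => c j a b) (fun j _ => hc j a b) (mem_univ j)
  have hCR : ∀ a b, C a b ≤ R a := fun a b => by
    rw [hR]; exact single_le_sum (f := fun b => C a b) (fun j _ => hC0 a j) (mem_univ b)
  have hcr : ∀ j a b, c j a b ≤ r j a := fun j a b => by
    rw [hr]; exact single_le_sum (f := fun b => c j a b) (fun b _ => hc j a b) (mem_univ b)
  have hct : ∀ j a b, c j a b ≤ t j b := fun j a b => by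
    rw [ht]; exact single_le_sum (f := fun a => c j a b) (fun a _ => hc j a b) (mem_univ a)
  have htT : ∀ j b, t j b ≤ T b := fun j b => by
    rw [hT]; exact single_le_sum (f := fun j => t j b) (fun j _ => ht0 j b) (mem_univ j)
  have hmN : ∀ j, m j ≤ N := fun j => by
    rw [hN]; exact single_le_sum (f := m) (fun j _ => (hm0 j).le) (mem_univ j)
  have key : ∀ j a b, c j a b * Real.log (C a b * N / (R a * T b)) ≤
      c j a b * Real.log (c j a b * m j / (r j a * t j b)) +
      (C a b * t j b * N * q a / (T b * R a) - c j a b) +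
      c j a b * (r j a / (m j * q a) - 1) := by
    intro j a b
    have hTb := hT0 b
    have hRa := hR0 a
    have hqa := hq a
    have hCab := hC0 a b
    have htb := ht0 j b
    rcases (hc j a b).eq_or_lt with h | h
    · rw [← h]
      have : 0 ≤ C a b * t j b * N * q a / (T b * R a) := by positivity
      linarith
    · have hq' : 0 < q a := by
        refine hqa.lt_of_ne fun h0 => ?_
        have := hsupp j a h0.symm
        linarith [hcr j a b]
      have h1 := h.trans_le (hcC j a b)
      have h2 := h1.trans_le (hCR a b)
      have h3 := h.trans_le (hcr j a b)
      have h4 := h.trans_le (hct j a b)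
      have h5 := h4.trans_le (htT j b)
      have h6 := hm0 j
      have h7 := h6.trans_le (hmN j)
      have e : C a b * N / (R a * T b) = c j a b * m j / (r j a * t j b) *
          (C a b * t j b * N * q a / (T b * R a) / c j a b) * (r j a / (m j * q a)) := by
        field_simp
      rw [e, Real.log_mul (by positivity) (by positivity), Real.log_mul (by positivity) (by positivity)]
      have l1 := Real.log_le_sub_one_of_pos
        (show 0 < C a b * t j b * N * q a / (T b * R a) / c j a b by positivity)
      have l2 := Real.log_le_sub_one_of_pos (show 0 < r j a / (m j * q a) by positivity)
      have l1' := mul_le_mul_of_nonneg_left l1 h.le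
      have l2' := mul_le_mul_of_nonneg_left l2 h.le
      rw [mul_sub, mul_div_cancel₀ _ h.ne'] at l1'
      linarith
  have hL : ∑ a, ∑ b, C a b * Real.log (C a b * N / (R a * T b)) =
      ∑ j, ∑ a, ∑ b, c j a b * Real.log (C a b * N / (R a * T b)) := by
    rw [sum_comm (s := univ (α := ι))]
    refine sum_congr rfl fun a _ => ?_
    rw [sum_comm (s := univ (α := ι))]
    refine sum_congr rfl fun b _ => ?_
    rw [← sum_mul, hC]
  have hsum : ∑ j, ∑ a, ∑ b, c j a b = N := by
    rw [hN]
    refine sum_congr rfl fun j _ => ?_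
    rw [hm]
    exact sum_congr rfl fun a _ => (hr j a).symm
  have hA : ∑ j, ∑ a, ∑ b, C a b * t j b * N * q a / (T b * R a) ≤ N := by
    calc _ = ∑ a, ∑ b, C a b * (T b / T b) * N * q a / R a := by
          rw [sum_comm]
          refine sum_congr rfl fun a _ => ?_
          rw [sum_comm]
          refine sum_congr rfl fun b _ => ?_
          conv_rhs => rw [hT b, sum_div, mul_sum, sum_mul, sum_mul, sum_div, ← hT b]
          refine sum_congr rfl fun j _ => ?_
          rw [div_mul_eq_div_div]
          ring
      _ ≤ ∑ a, ∑ b, C a b * 1 * N * q a / R a := by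
          gcongr with a _ b _
          all_goals first | exact hR0 _ | exact hq _ | exact hC0 _ _ | exact div_self_le_one _
      _ = ∑ a, (R a / R a) * (N * q a) := by
          refine sum_congr rfl fun a _ => ?_
          conv_rhs => rw [hR a, sum_div, sum_mul, ← hR a]
          refine sum_congr rfl fun b _ => ?_
          ring
      _ ≤ ∑ a, 1 * (N * q a) := by
          gcongr with a _
          · exact mul_nonneg hN0 (hq a)
          · exact div_self_le_one _
      _ = N := by simp [← mul_sum, hq1]
  have hB : ∑ j, ∑ a, ∑ b, c j a b * (r j a / (m j * q a) - 1) =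
      ∑ j, ∑ a, (r j a - m j * q a) ^ 2 / (m j * q a) := by
    refine sum_congr rfl fun j _ => ?_
    have : ∀ a, ∑ b, c j a b * (r j a / (m j * q a) - 1) =
        (r j a - m j * q a) ^ 2 / (m j * q a) + (r j a - m j * q a) := by
      intro a
      rw [← sum_mul, ← hr]
      have := hm0 j
      rcases (hq a).eq_or_lt with h | h
      · simp [← h, hsupp j a h.symm]
      · field_simp
        ring
    simp only [this, sum_add_distrib, sum_sub_distrib, ← mul_sum, hq1, ← hm]
    ring
  have := sum_le_sum fun j (_ : j ∈ univ) => sum_le_sum fun a (_ : a ∈ univ) =>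
    sum_le_sum fun b (_ : b ∈ univ) => key j a b
  simp only [sum_add_distrib, sum_sub_distrib, hB, hsum] at this
  rw [hL]
  linarith

end

theorem card_mul_empMIOn {n : ℕ} {X Y : Type*} [Fintype X] [Fintype Y]
    [DecidableEq X] [DecidableEq Y] (s : Finset (Fin n)) (x : Fin n → X) (y : Fin n → Y) :
    (s.card : ℝ) * empMIOn s x y = ∑ a, ∑ b,
      ((s.filter fun i => x i = a ∧ y i = b).card : ℝ) *
        Real.log (((s.filter fun i => x i = a ∧ y i = b).card : ℝ) * s.card /
          (((s.filter fun i => x i = a).card : ℝ) * ((s.filter fun i => y i = b).card : ℝ))) := by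
  unfold empMIOn empJointOn empMargXOn empMargYOn
  rw [Finset.mul_sum]
  refine Finset.sum_congr rfl fun a _ => ?_
  rw [Finset.mul_sum]
  refine Finset.sum_congr rfl fun b _ => ?_
  rcases (Nat.cast_nonneg (α := ℝ) (s.filter fun i => x i = a ∧ y i = b).card).eq_or_lt
    with h | h
  · simp [← h]
  · have hs : (0 : ℝ) < s.card := h.trans_le (by gcongr; exact Finset.filter_subset _ _)
    rw [if_pos (by positivity), ← mul_assoc, mul_div_cancel₀ _ hs.ne']
    congr 2
    field_simp

theorem card_filter_eq_sum_inter {n : ℕ} {Z : Type*} [Fintype Z] [DecidableEq Z]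
    (s : Finset (Fin n)) (p : Fin n → Prop) [DecidablePred p] (z : Fin n → Z) :
    ((s.filter p).card : ℝ) = ∑ b, ((s.filter fun i => p i ∧ z i = b).card : ℝ) := by
  rw [Finset.card_eq_sum_card_fiberwise (f := z) (t := Finset.univ) (by simp)]
  push_cast
  simp only [Finset.filter_filter]

theorem card_filter_eq_sum_partition {n : ℕ} {ι : Type*} [Fintype ι] (S : ι → Finset (Fin n))
    (hd : ∀ j j', j ≠ j' → Disjoint (S j) (S j')) (hu : Finset.univ.biUnion S = Finset.univ)
    (p : Fin n → Prop) [DecidablePred p] :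
    ((Finset.univ.filter p).card : ℝ) = ∑ j, (((S j).filter p).card : ℝ) := by
  rw [← hu, Finset.filter_biUnion, Finset.card_biUnion, Nat.cast_sum]
  exact fun j _ j' _ h => Finset.disjoint_filter_filter (hd j j' h)

theorem card_mul_empMIOn_univ_le {n : ℕ} {ι X Y : Type*} [Fintype ι] [Fintype X] [Fintype Y]
    [DecidableEq X] [DecidableEq Y] (S : ι → Finset (Fin n)) (hne : ∀ j, (S j).Nonempty)
    (hd : ∀ j j', j ≠ j' → Disjoint (S j) (S j')) (hu : Finset.univ.biUnion S = Finset.univ)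
    (q : X → ℝ) (hq : ∀ a, 0 ≤ q a) (hq1 : ∑ a, q a = 1)
    (x : Fin n → X) (y : Fin n → Y) (hx : ∀ i, q (x i) ≠ 0) :
    (n : ℝ) * empMIOn Finset.univ x y ≤ ∑ j, ((S j).card : ℝ) * empMIOn (S j) x y +
      ∑ j, ∑ a, ((((S j).filter fun i => x i = a).card : ℝ) - (S j).card * q a) ^ 2 /
        ((S j).card * q a) := by
  have hn : (n : ℝ) = (Finset.univ : Finset (Fin n)).card := by simp
  rw [hn]
  simp only [card_mul_empMIOn]
  refine sum_mul_log_le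
    (fun j a b => (((S j).filter fun i => x i = a ∧ y i = b).card : ℝ)) (by intros; positivity)
    q hq hq1
    (fun j a => (((S j).filter fun i => x i = a).card : ℝ))
    (fun j a => card_filter_eq_sum_inter (S j) _ y)
    (fun j b => (((S j).filter fun i => y i = b).card : ℝ))
    (fun j b => by
      simpa only [and_comm] using card_filter_eq_sum_inter (S j) (fun i => y i = b) x)
    (fun j => ((S j).card : ℝ))
    (fun j => by simpa using card_filter_eq_sum_inter (S j) (fun _ => True) x)
    (fun a b => ((Finset.univ.filter fun i => x i = a ∧ y i = b).card : ℝ))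
    (fun a b => card_filter_eq_sum_partition S hd hu _)
    (fun a => ((Finset.univ.filter fun i => x i = a).card : ℝ))
    (fun a => card_filter_eq_sum_inter _ _ y)
    (fun b => ((Finset.univ.filter fun i => y i = b).card : ℝ))
    (fun b => card_filter_eq_sum_partition S hd hu _)
    _
    (by simpa using card_filter_eq_sum_partition S hd hu (fun _ => True))
    (fun j => by have := (hne j).card_pos; positivity)
    ?_
  intro j a ha
  have : ∀ i ∈ S j, x i ≠ a := fun i _ h => hx i (h ▸ ha)
  simpa [Finset.filter_eq_empty_iff] using this

theorem sum_toReal_pmf {X : Type*} [Fintype X] (Q : PMF X) : ∑ a, (Q a).toReal = 1 := by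
  rw [← ENNReal.toReal_sum fun a _ => Q.apply_ne_top a, ← tsum_fintype (L := .unconditional X),
    Q.tsum_coe, ENNReal.toReal_one]

theorem integral_sq_card_filter_sub_le {n : ℕ} {X : Type*} [Fintype X] [DecidableEq X]
    [MeasurableSpace X] [MeasurableSingletonClass X] (Q : PMF X) (s : Finset (Fin n)) (a : X) :
    ∫ x, (((s.filter fun i => x i = a).card : ℝ) - s.card * (Q a).toReal) ^ 2
        ∂(Measure.pi fun _ : Fin n => Q.toMeasure) ≤ s.card * (Q a).toReal := by
  let f : Fin n → X → ℝ := fun i z => if i ∈ s then ({a} : Set X).indicator 1 z else 0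
  have hf : ∀ i, MemLp (f i) 2 Q.toMeasure := fun i => .of_discrete
  have hcard : ∀ x : Fin n → X,
      ((s.filter fun i => x i = a).card : ℝ) = (∑ i, fun x : Fin n → X => f i (x i)) x := by
    intro x
    simp [f, Finset.sum_apply, Set.indicator_apply]
  have hfi : ∀ i, ∫ z, f i z ∂Q.toMeasure = if i ∈ s then (Q a).toReal else 0 := by
    intro i
    by_cases h : i ∈ s
    · simp only [f, h, if_true]
      rw [integral_indicator_one (measurableSet_singleton a), Measure.real,
        Q.toMeasure_apply_singleton a (measurableSet_singleton a)]
    · simp [f, h]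
  have hvar : ∀ i, ProbabilityTheory.variance (f i) Q.toMeasure ≤
      if i ∈ s then (Q a).toReal else 0 := by
    intro i
    refine (ProbabilityTheory.variance_le_expectation_sq
      (hf i).aestronglyMeasurable).trans_eq ?_
    rw [← hfi]
    congr 1
    ext z
    simp only [Pi.pow_apply, f, Set.indicator_apply]
    split_ifs <;> simp
  have hmean : ∫ x, (∑ i, fun x : Fin n → X => f i (x i)) x
      ∂(Measure.pi fun _ : Fin n => Q.toMeasure) = s.card * (Q a).toReal := by
    simp only [Finset.sum_apply]
    rw [integral_finsetSum _ fun i _ => Integrable.of_finite]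
    simp only [integral_comp_eval (μ := fun _ : Fin n => Q.toMeasure)
      (hf _).aestronglyMeasurable, hfi]
    simp
  simp only [hcard]
  rw [← hmean, ← ProbabilityTheory.variance_eq_integral (AEMeasurable.of_discrete),
    ProbabilityTheory.variance_sum_pi hf, hmean]
  refine (Finset.sum_le_sum fun i _ => hvar i).trans_eq ?_
  simp

theorem integral_chiSq_le {n : ℕ} {ι X : Type*} [Fintype ι] [Fintype X] [DecidableEq X]
    [MeasurableSpace X] [MeasurableSingletonClass X] (Q : PMF X) (S : ι → Finset (Fin n)) :
    ∫ x, ∑ j, ∑ a, ((((S j).filter fun i => x i = a).card : ℝ) -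
        (S j).card * (Q a).toReal) ^ 2 / ((S j).card * (Q a).toReal)
        ∂(Measure.pi fun _ : Fin n => Q.toMeasure) ≤ Fintype.card ι * Fintype.card X := by
  rw [integral_finsetSum _ fun j _ => Integrable.of_finite]
  simp only [integral_finsetSum _ fun a _ => Integrable.of_finite, integral_div]
  calc _ ≤ ∑ _j : ι, ∑ _a : X, (1 : ℝ) := by
        refine Finset.sum_le_sum fun j _ => Finset.sum_le_sum fun a _ => ?_
        exact div_le_one_of_le₀ (integral_sq_card_filter_sub_le Q (S j) a) (by positivity)
    _ = _ := by simp

theorem ae_pi_toMeasure_ne_zero {ι X : Type*} [Fintype ι] [Fintype X] [MeasurableSpace X]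
    [MeasurableSingletonClass X] (Q : PMF X) :
    ∀ᵐ x ∂(Measure.pi fun _ : ι => Q.toMeasure), ∀ i, Q (x i) ≠ 0 := by
  rw [ae_all_iff]
  intro i
  have h : ∀ᵐ z ∂Q.toMeasure, Q z ≠ 0 := by
    rw [ae_iff, Q.toMeasure_apply_eq_zero_iff .of_discrete]
    exact Set.disjoint_left.2 fun z hz h => h ((PMF.mem_support_iff _ _).1 hz)
  exact (measurePreserving_eval (fun _ : ι => Q.toMeasure) i).quasiMeasurePreserving.ae h

/-- Likely convexity, discrete case (Lemma 5 of the full paper, fixed number of subsets):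
for every `L`, `Δ > 0`, `P_A > 0` there is `n₀` such that for every `n ≥ n₀` and every
partition of the index set into `L` nonempty subsets there is a set `J` of input sequences
with `Q^n(J) ≤ P_A` such that for every `x ∉ J` and every `y`, the size-weighted average of
the per-subset empirical mutual informations is at least `Î(x;y) − Δ`. -/
theorem likely_convexity_discrete {X Y : Type*} [Fintype X] [Fintype Y]
    [DecidableEq X] [DecidableEq Y] [MeasurableSpace X] [MeasurableSingletonClass X]
    (Q : PMF X) (L : ℕ) (hL : 0 < L) (Δ PA : ℝ) (hΔ : 0 < Δ) (hPA : 0 < PA) :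
    ∃ n₀ : ℕ, ∀ n, n₀ ≤ n → ∀ S : Fin L → Finset (Fin n),
      (∀ j, (S j).Nonempty) →
      (∀ j j', j ≠ j' → Disjoint (S j) (S j')) →
      (Finset.univ.biUnion S = Finset.univ) →
      ∃ J : Set (Fin n → X),
        (Measure.pi fun _ : Fin n => Q.toMeasure) J ≤ ENNReal.ofReal PA ∧
        ∀ x : Fin n → X, x ∉ J → ∀ y : Fin n → Y,
          ∑ j : Fin L, ((S j).card : ℝ) / n * empMIOn (S j) x y
            ≥ empMIOn Finset.univ x y - Δ := by
  obtain ⟨n₀, hn₀⟩ := exists_nat_ge ((L : ℝ) * Fintype.card X / (Δ * PA))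
  refine ⟨n₀, fun n hn S hne hd hu => ?_⟩
  have hn0 : (0 : ℝ) < n := by
    obtain ⟨i, -⟩ := hne ⟨0, hL⟩
    exact_mod_cast i.pos
  let μ := Measure.pi fun _ : Fin n => Q.toMeasure
  let G : (Fin n → X) → ℝ := fun x => ∑ j, ∑ a,
    ((((S j).filter fun i => x i = a).card : ℝ) - (S j).card * (Q a).toReal) ^ 2 /
      ((S j).card * (Q a).toReal)
  have hG0 : ∀ x, 0 ≤ G x := fun x => by positivity
  refine ⟨{x | n * Δ ≤ G x} ∪ {x | ¬ ∀ i, Q (x i) ≠ 0}, ?_, fun x hx y => ?_⟩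
  · refine (measure_union_le _ _).trans ?_
    rw [ae_iff.1 (ae_pi_toMeasure_ne_zero Q), add_zero]
    refine (ENNReal.le_ofReal_iff_toReal_le (measure_ne_top _ _) hPA.le).2 ?_
    have hmarkov := (mul_meas_ge_le_integral_of_nonneg (μ := μ) (Filter.Eventually.of_forall hG0)
      Integrable.of_finite (n * Δ)).trans (integral_chiSq_le Q S)
    rw [Fintype.card_fin] at hmarkov
    have hLX : (L : ℝ) * Fintype.card X ≤ n * Δ * PA := by
      rw [div_le_iff₀ (by positivity)] at hn₀
      have : (n₀ : ℝ) ≤ n := by exact_mod_cast hn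
      calc _ ≤ n₀ * (Δ * PA) := hn₀
        _ ≤ n * (Δ * PA) := by gcongr
        _ = _ := by ring
    exact le_of_mul_le_mul_left (hmarkov.trans hLX) (by positivity)
  · simp only [Set.mem_union, Set.mem_ofPred_eq, not_or, not_le, not_not] at hx
    have hmain := card_mul_empMIOn_univ_le S hne hd hu (fun a => (Q a).toReal)
      (fun a => ENNReal.toReal_nonneg) (sum_toReal_pmf Q) x y
      fun i => ENNReal.toReal_ne_zero.2 ⟨hx.2 i, Q.apply_ne_top _⟩
    have hsum : ∑ j, ((S j).card : ℝ) / n * empMIOn (S j) x y =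
        (∑ j, ((S j).card : ℝ) * empMIOn (S j) x y) / n := by
      rw [Finset.sum_div]
      exact Finset.sum_congr rfl fun j _ => by ring
    rw [hsum, ge_iff_le, le_div_iff₀ hn0]
    have := hx.1
    simp only [G] at this
    linarith
end

section
/- (Likely convexity, continuous case; Lemma 6 of the full paper, fixed number of subsets.) Fix P > 0, a positive integer L, and reals Δ > 0 and P_A > 0. Then there exists n₀ such that for every n ≥ n₀ and every partition of {1,…,n} into nonempty subsets S₁,…,S_L, there exists a measurable set J ⊆ ℝ^n whose probability under the n-fold product of the Gaussian law N(0,P) is at most P_A, such that for every x ∈ ℝ^n with x ∉ J and every y ∈ ℝ^n: Σ_{j=1}^{L} (|S_j|/n)·ρ̂²(x|_{S_j}, y|_{S_j}) ≥ ρ̂²(x, y) − Δ, where x|_{S_j}, y|_{S_j} denote the subvectors indexed by S_j, and ρ̂²(u,v) is taken to be 0 whenever u = 0 or v = 0. -/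
open MeasureTheory ProbabilityTheory

/-- Squared empirical correlation factor of the subvectors of `x` and `y` indexed by `s`:
`ρ̂²(x|_s, y|_s) = ⟨x|_s, y|_s⟩² / (‖x|_s‖²·‖y|_s‖²)`, with the convention that it is `0`
when either subvector is zero. -/
noncomputable def rhoSqOn {n : ℕ} (s : Finset (Fin n)) (x y : Fin n → ℝ) : ℝ :=
  if (∑ i ∈ s, x i ^ 2) = 0 ∨ (∑ i ∈ s, y i ^ 2) = 0 then 0
  else (∑ i ∈ s, x i * y i) ^ 2 / ((∑ i ∈ s, x i ^ 2) * (∑ i ∈ s, y i ^ 2))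

/-- On each block, `⟨x|_s, y|_s⟩² = ρ̂²(x|_s, y|_s)·‖x|_s‖²·‖y|_s‖²`, also in the degenerate case. -/
theorem sq_inner_eq_rhoSqOn_mul {n : ℕ} (s : Finset (Fin n)) (x y : Fin n → ℝ) :
    (∑ i ∈ s, x i * y i) ^ 2
      = rhoSqOn s x y * (∑ i ∈ s, x i ^ 2) * (∑ i ∈ s, y i ^ 2) := by
  unfold rhoSqOn
  split_ifs with h
  · have hcs := Finset.sum_mul_sq_le_sq_mul_sq s x y
    have h0 : (∑ i ∈ s, x i ^ 2) * (∑ i ∈ s, y i ^ 2) = 0 := mul_eq_zero.2 h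
    rw [h0] at hcs
    simpa using le_antisymm hcs (sq_nonneg _)
  · push Not at h
    field_simp [h.1, h.2]

theorem rhoSqOn_nonneg {n : ℕ} (s : Finset (Fin n)) (x y : Fin n → ℝ) :
    0 ≤ rhoSqOn s x y := by
  unfold rhoSqOn
  split_ifs
  · exact le_rfl
  · positivity

theorem rhoSqOn_le_one {n : ℕ} (s : Finset (Fin n)) (x y : Fin n → ℝ) :
    rhoSqOn s x y ≤ 1 := by
  unfold rhoSqOn
  split_ifs
  · exact zero_le_one
  · exact div_le_one_of_le₀ (Finset.sum_mul_sq_le_sq_mul_sq s x y) (by positivity)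

/-- Convexity of `ρ̂²` when the blocks are weighted by their share of the energy of `x`. -/
theorem rhoSqOn_univ_mul_le {n L : ℕ} (S : Fin L → Finset (Fin n))
    (hdisj : ∀ j j', j ≠ j' → Disjoint (S j) (S j'))
    (hcover : Finset.univ.biUnion S = Finset.univ) (x y : Fin n → ℝ) :
    rhoSqOn Finset.univ x y * (∑ i, x i ^ 2)
      ≤ ∑ j, rhoSqOn (S j) x y * ∑ i ∈ S j, x i ^ 2 := by
  have split (f : Fin n → ℝ) : ∑ i, f i = ∑ j, ∑ i ∈ S j, f i := by
    rw [← hcover, Finset.sum_biUnion fun j _ j' _ h => hdisj j j' h]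
  have hnn : ∀ j, 0 ≤ rhoSqOn (S j) x y * ∑ i ∈ S j, x i ^ 2 := fun j =>
    mul_nonneg (rhoSqOn_nonneg _ _ _) (Finset.sum_nonneg fun _ _ => sq_nonneg _)
  have hy : 0 ≤ ∑ i, y i ^ 2 := Finset.sum_nonneg fun _ _ => sq_nonneg _
  rcases hy.eq_or_lt with hy | hy
  · simpa [rhoSqOn, ← hy] using Finset.sum_nonneg fun j _ => hnn j
  · refine le_of_mul_le_mul_right ?_ hy
    rw [← sq_inner_eq_rhoSqOn_mul, split (fun i => x i * y i), split (fun i => y i ^ 2)]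
    exact Finset.sum_sq_le_sum_mul_sum_of_sq_le_mul _ (fun j _ => hnn j)
      (fun j _ => Finset.sum_nonneg fun _ _ => sq_nonneg _)
      (fun j _ => (sq_inner_eq_rhoSqOn_mul _ _ _).le)

/-- If the energy of every block of `x` is within `δ n P` of `|S_j| P`, then `ρ̂²` is convex up
to `Δ` when the blocks are weighted by their sizes. -/
theorem rhoSqOn_univ_sub_le {n L : ℕ} (hL : 0 < L) (hn : 0 < n) {P Δ δ : ℝ} (hP : 0 < P)
    (hδ : 2 * L * δ ≤ 1) (hδΔ : 2 * L * (L + 1) * δ ≤ Δ) (hδ0 : 0 < δ)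
    (S : Fin L → Finset (Fin n))
    (hdisj : ∀ j j', j ≠ j' → Disjoint (S j) (S j'))
    (hcover : Finset.univ.biUnion S = Finset.univ) (x y : Fin n → ℝ)
    (hx : ∀ j, |∑ i ∈ S j, x i ^ 2 - (S j).card * P| < δ * n * P) :
    rhoSqOn Finset.univ x y - Δ ≤ ∑ j, ((S j).card : ℝ) / n * rhoSqOn (S j) x y := by
  have hn' : (0 : ℝ) < n := by exact_mod_cast hn
  have hL' : (0 : ℝ) < L := by exact_mod_cast hL
  set A := ∑ i, x i ^ 2 with hA
  have hsum : A = ∑ j, ∑ i ∈ S j, x i ^ 2 := by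
    rw [hA, ← hcover, Finset.sum_biUnion fun j _ j' _ h => hdisj j j' h]
  have hcard : (n : ℝ) = ∑ j, ((S j).card : ℝ) := by
    rw [← Nat.cast_sum, ← Finset.card_biUnion fun j _ j' _ h => hdisj j j' h, hcover]
    simp
  have hAdev : |A - n * P| ≤ L * (δ * n * P) := by
    have : A - n * P = ∑ j, (∑ i ∈ S j, x i ^ 2 - (S j).card * P) := by
      rw [Finset.sum_sub_distrib, ← Finset.sum_mul, ← hcard, hsum]
    rw [this]
    refine (Finset.abs_sum_le_sum_abs _ _).trans ?_
    refine (Finset.sum_le_sum fun j _ => (hx j).le).trans ?_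
    simp
  have hnP : 0 < n * P := by positivity
  have hAlow : n * P / 2 ≤ A := by
    have := (abs_le.1 hAdev).1
    nlinarith
  have hApos : 0 < A := by linarith
  have hblock : ∀ j, (∑ i ∈ S j, x i ^ 2) ≤ A * ((S j).card / n + Δ / L) := by
    intro j
    have hs : ((S j).card : ℝ) ≤ n := by
      exact_mod_cast (Finset.card_le_univ _).trans_eq (Fintype.card_fin n)
    have h1 := (abs_lt.1 (hx j)).2
    have h2 : n * P - A ≤ L * (δ * n * P) := by linarith [(abs_le.1 hAdev).1]
    have h3 : (S j).card / n * (n * P - A) ≤ L * (δ * n * P) := by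
      have hq : ((S j).card : ℝ) / n ≤ 1 := div_le_one_of_le₀ hs hn'.le
      have hq0 : (0 : ℝ) ≤ (S j).card / n := by positivity
      calc _ ≤ (S j).card / n * (L * (δ * n * P)) := mul_le_mul_of_nonneg_left h2 hq0
        _ ≤ _ := mul_le_of_le_one_left (by positivity) hq
    have h4 : ((S j).card : ℝ) / n * (n * P) = (S j).card * P := by field_simp
    have h5 : (L + 1) * (δ * n * P) ≤ A * (Δ / L) := by
      have h6 : 2 * (L + 1) * δ ≤ Δ / L := by
        rw [le_div_iff₀ hL']; linarith
      calc (L + 1) * (δ * n * P) = n * P / 2 * (2 * (L + 1) * δ) := by ring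
        _ ≤ A * (Δ / L) := mul_le_mul hAlow h6 (by positivity) hApos.le
    nlinarith
  have key : rhoSqOn Finset.univ x y * A
      ≤ A * ∑ j, ((S j).card / n + Δ / L) * rhoSqOn (S j) x y := by
    refine (rhoSqOn_univ_mul_le S hdisj hcover x y).trans ?_
    rw [Finset.mul_sum]
    refine Finset.sum_le_sum fun j _ => ?_
    rw [mul_comm, ← mul_assoc]
    exact mul_le_mul_of_nonneg_right (hblock j) (rhoSqOn_nonneg _ _ _)
  rw [mul_comm] at key
  have key' := le_of_mul_le_mul_left key hApos
  have hΔ : 0 ≤ Δ := le_trans (by positivity) hδΔ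
  have hrest : ∑ j, Δ / L * rhoSqOn (S j) x y ≤ Δ := by
    calc _ ≤ ∑ _j : Fin L, Δ / L := Finset.sum_le_sum fun j _ =>
          mul_le_of_le_one_right (by positivity) (rhoSqOn_le_one _ _ _)
      _ = Δ := by simp; field_simp
  simp only [add_mul, Finset.sum_add_distrib] at key'
  linarith

theorem memLp_sq_gaussianReal (v : NNReal) :
    MemLp (fun t : ℝ => t ^ 2) 2 (gaussianReal 0 v) := by
  have h : MemLp (id : ℝ → ℝ) 4 (gaussianReal 0 v) := memLp_id_gaussianReal 4
  rw [memLp_two_iff_integrable_sq (by fun_prop)]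
  have := h.integrable_norm_pow (by norm_num)
  refine this.congr (Filter.Eventually.of_forall fun t => ?_)
  simp only [id, Real.norm_eq_abs]
  rw [← pow_mul]
  exact (by decide : Even 4).pow_abs t

theorem integral_sq_gaussianReal (v : NNReal) :
    ∫ t, t ^ 2 ∂(gaussianReal 0 v) = v := by
  have h := variance_id_gaussianReal (μ := 0) (v := v)
  rwa [variance_of_integral_eq_zero (by fun_prop) (by simp)] at h

/-- Chebyshev's inequality for the energy of a block of i.i.d. centered Gaussians. -/
theorem pi_gaussianReal_energy_dev_le {n : ℕ} {P c : ℝ} (hP : 0 < P) (hc : 0 < c)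
    (s : Finset (Fin n)) :
    (Measure.pi fun _ : Fin n => gaussianReal 0 P.toNNReal)
        {x | c ≤ |∑ i ∈ s, x i ^ 2 - s.card * P|}
      ≤ ENNReal.ofReal
          (n * variance (fun t : ℝ => t ^ 2) (gaussianReal 0 P.toNNReal) / c ^ 2) := by
  set g := gaussianReal 0 P.toNNReal with hg
  set μ := Measure.pi fun _ : Fin n => g
  have hev (i : Fin n) : MeasurePreserving (fun x : Fin n → ℝ => x i) μ g :=
    measurePreserving_eval (fun _ : Fin n => g) i
  have hL2 := memLp_sq_gaussianReal P.toNNReal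
  have hmem (i : Fin n) : MemLp (fun x : Fin n → ℝ => x i ^ 2) 2 μ :=
    hL2.comp_measurePreserving (hev i)
  have hmean : ∫ x, ∑ i ∈ s, x i ^ 2 ∂μ = s.card * P := by
    rw [integral_finsetSum _ fun i _ => (hmem i).integrable one_le_two]
    have (i : Fin n) : ∫ x, x i ^ 2 ∂μ = P := by
      have h := integral_comp_eval (μ := fun _ : Fin n => g) (i := i)
        (f := fun t : ℝ => t ^ 2) (by fun_prop)
      rw [h, hg, integral_sq_gaussianReal, Real.coe_toNNReal _ hP.le]
    simp [this]
  have hvar : variance (fun x => ∑ i ∈ s, x i ^ 2) μ = s.card * variance (fun t : ℝ => t ^ 2) g := by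
    have hind : iIndepFun (fun (i : Fin n) (x : Fin n → ℝ) => x i ^ 2) μ :=
      iIndepFun_pi (X := fun _ t => t ^ 2) fun _ => by fun_prop
    have h := IndepFun.variance_sum (s := s) (fun i _ => hmem i)
      (fun i _ j _ hij => hind.indepFun hij)
    have h1 (i : Fin n) : variance (fun x : Fin n → ℝ => x i ^ 2) μ
        = variance (fun t : ℝ => t ^ 2) g :=
      (hev i).variance_fun_comp (f := fun t : ℝ => t ^ 2) (by fun_prop)
    simp only [h1, Finset.sum_const, nsmul_eq_mul] at h
    rw [← h]
    congr 1
    ext x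
    simp
  have hcheb := meas_ge_le_variance_div_sq (μ := μ) (X := fun x => ∑ i ∈ s, x i ^ 2)
    (memLp_finsetSum s fun i _ => hmem i) hc
  rw [hmean, hvar] at hcheb
  refine hcheb.trans (ENNReal.ofReal_le_ofReal ?_)
  have hs : (s.card : ℝ) ≤ n := by
    exact_mod_cast (Finset.card_le_univ s).trans_eq (Fintype.card_fin n)
  gcongr
  exact variance_nonneg _ _

/-- Likely convexity, continuous case (Lemma 6 of the full paper, fixed number of subsets):
for every `P > 0`, `L`, `Δ > 0`, `P_A > 0` there is `n₀` such that for every `n ≥ n₀` and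
every partition of the index set into `L` nonempty subsets there is a measurable set
`J ⊆ ℝⁿ` of probability at most `P_A` under `N(0,P)^n` such that for every `x ∉ J` and
every `y`, the size-weighted average of the per-subset squared correlation factors is at
least `ρ̂²(x,y) − Δ`. -/
theorem likely_convexity_continuous (P : ℝ) (hP : 0 < P)
    (L : ℕ) (hL : 0 < L) (Δ PA : ℝ) (hΔ : 0 < Δ) (hPA : 0 < PA) :
    ∃ n₀ : ℕ, ∀ n, n₀ ≤ n → ∀ S : Fin L → Finset (Fin n),
      (∀ j, (S j).Nonempty) →
      (∀ j j', j ≠ j' → Disjoint (S j) (S j')) →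
      (Finset.univ.biUnion S = Finset.univ) →
      ∃ J : Set (Fin n → ℝ), MeasurableSet J ∧
        (Measure.pi fun _ : Fin n => gaussianReal 0 P.toNNReal) J ≤ ENNReal.ofReal PA ∧
        ∀ x : Fin n → ℝ, x ∉ J → ∀ y : Fin n → ℝ,
          ∑ j : Fin L, ((S j).card : ℝ) / n * rhoSqOn (S j) x y
            ≥ rhoSqOn Finset.univ x y - Δ := by
  set V := variance (fun t : ℝ => t ^ 2) (gaussianReal 0 P.toNNReal)
  have hV : 0 ≤ V := variance_nonneg _ _
  have hL' : (0 : ℝ) < L := by exact_mod_cast hL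
  obtain ⟨δ, hδ0, hδ, hδΔ⟩ :
      ∃ δ : ℝ, 0 < δ ∧ 2 * L * δ ≤ 1 ∧ 2 * L * (L + 1) * δ ≤ Δ := by
    refine ⟨min (1 / (2 * L)) (Δ / (2 * L * (L + 1))), by positivity, ?_, ?_⟩
    · rw [← le_div_iff₀' (by positivity)]
      exact min_le_left _ _
    · rw [← le_div_iff₀' (by positivity)]
      exact min_le_right _ _
  obtain ⟨n₀, hn₀⟩ := exists_nat_ge (L * V / (PA * (δ * P) ^ 2))
  refine ⟨n₀ + 1, fun n hn S _ hdisj hcover => ?_⟩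
  have hn0 : 0 < n := by omega
  have hn' : (0 : ℝ) < n := by exact_mod_cast hn0
  refine ⟨⋃ j, {x | δ * n * P ≤ |∑ i ∈ S j, x i ^ 2 - (S j).card * P|},
    MeasurableSet.iUnion fun j => measurableSet_le (by fun_prop) (by fun_prop), ?_, ?_⟩
  · refine (measure_iUnion_fintype_le _ _).trans ?_
    refine (Finset.sum_le_sum fun j _ =>
      pi_gaussianReal_energy_dev_le hP (by positivity) (S j)).trans ?_
    rw [← ENNReal.ofReal_sum_of_nonneg fun _ _ => by positivity]
    refine ENNReal.ofReal_le_ofReal ?_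
    have hle : L * V / (PA * (δ * P) ^ 2) ≤ n :=
      hn₀.trans (by exact_mod_cast (Nat.le_succ n₀).trans hn)
    rw [div_le_iff₀ (by positivity)] at hle
    rw [Finset.sum_const, Finset.card_univ, Fintype.card_fin, nsmul_eq_mul, ← mul_div_assoc,
      div_le_iff₀ (by positivity)]
    nlinarith [mul_le_mul_of_nonneg_left hle hn'.le]
  · intro x hx y
    simp only [Set.mem_iUnion, Set.mem_ofPred_eq, not_exists, not_le] at hx
    exact rhoSqOn_univ_sub_le hL hn0 hP hδ hδΔ hδ0 S hdisj hcover x y hx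
end

section
/- For every δ > 0 and ε > 0 there exists n₀ such that for all n ≥ n₀ the following holds uniformly over all error sequences: for every e ∈ {0,1}^n with fraction of ones ε̂ = (1/n)|{i : e_i = 1}|, if X = (X₁,…,X_n) has i.i.d. coordinates uniform on {0,1} (i.e. Bernoulli(1/2)) and y = X ⊕ e (coordinatewise addition modulo 2), then Pr( Î₂(X; X ⊕ e) < 1 − h_b(ε̂) − δ ) ≤ ε. -/
open MeasureTheory

/-- Empirical joint distribution of two binary sequences. -/
noncomputable def empJoint2 (n : ℕ) (x y : Fin n → Bool) (a b : Bool) : ℝ :=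
  ((Finset.univ.filter fun i => x i = a ∧ y i = b).card : ℝ) / n

/-- Empirical marginal of a binary sequence. -/
noncomputable def empMarg2 (n : ℕ) (x : Fin n → Bool) (a : Bool) : ℝ :=
  ((Finset.univ.filter fun i => x i = a).card : ℝ) / n

/-- Base-2 empirical mutual information, summing over pairs with `P̂_{xy}(a,b) > 0`. -/
noncomputable def empMI2 (n : ℕ) (x y : Fin n → Bool) : ℝ :=
  ∑ a : Bool, ∑ b : Bool,
    if 0 < empJoint2 n x y a b then
      empJoint2 n x y a b *
        Real.logb 2 (empJoint2 n x y a b / (empMarg2 n x a * empMarg2 n y b))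
    else 0

/-- Binary entropy function `h_b(p) = −p·log₂ p − (1−p)·log₂(1−p)`
(with the conventions `h_b(0) = h_b(1) = 0`, automatic since `logb 2 0 = 0`). -/
noncomputable def binEnt (p : ℝ) : ℝ :=
  -(p * Real.logb 2 p) - (1 - p) * Real.logb 2 (1 - p)

theorem empJoint2_add_eq_empMarg2_left (n : ℕ) (x y : Fin n → Bool) (a : Bool) :
    empJoint2 n x y a true + empJoint2 n x y a false = empMarg2 n x a := by
  unfold empJoint2 empMarg2
  rw [← add_div, Finset.card_filter, Finset.card_filter, Finset.card_filter]
  push_cast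
  rw [← Finset.sum_add_distrib]
  congr 1
  refine Finset.sum_congr rfl fun i _ => ?_
  cases x i <;> cases y i <;> cases a <;> simp

theorem empJoint2_add_eq_empMarg2_xor (n : ℕ) (x e : Fin n → Bool) (c : Bool) :
    empJoint2 n x (fun i => xor (x i) (e i)) true (xor true c) +
      empJoint2 n x (fun i => xor (x i) (e i)) false c = empMarg2 n e c := by
  unfold empJoint2 empMarg2
  rw [← add_div, Finset.card_filter, Finset.card_filter, Finset.card_filter]
  push_cast
  rw [← Finset.sum_add_distrib]
  congr 1
  refine Finset.sum_congr rfl fun i _ => ?_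
  cases x i <;> cases e i <;> cases c <;> simp

theorem empMarg2_true_add_false {n : ℕ} (hn : 0 < n) (x : Fin n → Bool) :
    empMarg2 n x true + empMarg2 n x false = 1 := by
  have hn' : (n : ℝ) ≠ 0 := by positivity
  unfold empMarg2
  rw [← add_div, Finset.card_filter, Finset.card_filter, div_eq_one_iff_eq hn']
  push_cast
  rw [← Finset.sum_add_distrib]
  trans ∑ _i : Fin n, (1 : ℝ)
  · refine Finset.sum_congr rfl fun i _ => ?_
    cases x i <;> simp
  · simp

theorem empJoint2_le_empMarg2_left (n : ℕ) (x y : Fin n → Bool) (a b : Bool) :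
    empJoint2 n x y a b ≤ empMarg2 n x a := by
  unfold empJoint2 empMarg2
  gcongr
  tauto

theorem empJoint2_le_empMarg2_right (n : ℕ) (x y : Fin n → Bool) (a b : Bool) :
    empJoint2 n x y a b ≤ empMarg2 n y b := by
  unfold empJoint2 empMarg2
  gcongr
  tauto

theorem empJoint2_le_empMarg2_xor (n : ℕ) (x e : Fin n → Bool) (a b : Bool) :
    empJoint2 n x (fun i => xor (x i) (e i)) a b ≤ empMarg2 n e (xor a b) := by
  unfold empJoint2 empMarg2
  gcongr with i
  rintro ⟨rfl, rfl⟩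
  simp

/-- Lower bound for one summand of a mutual information, comparing the joint weight `j` with the
product `p * q`. -/
theorem mul_logb_div_ge {j p r q M : ℝ} (hj : 0 ≤ j) (hjp : j ≤ p) (hjr : j ≤ r) (hjq : j ≤ q)
    (hrM : r ≤ M) :
    j * (-Real.logb 2 M) + j * Real.logb 2 q + (j - p * q) / Real.log 2 ≤
      if 0 < j then j * Real.logb 2 (j / (p * r)) else 0 := by
  have hlog2 : 0 < Real.log 2 := Real.log_pos one_lt_two
  rcases hj.eq_or_lt with rfl | hj
  · have : 0 ≤ p * q := mul_nonneg hjp hjq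
    simpa using div_nonpos_of_nonpos_of_nonneg (neg_nonpos.2 this) hlog2.le
  have hp : 0 < p := hj.trans_le hjp
  have hr : 0 < r := hj.trans_le hjr
  have hq : 0 < q := hj.trans_le hjq
  rw [if_pos hj]
  simp only [Real.logb]
  have hlogr : Real.log r ≤ Real.log M := Real.log_le_log hr hrM
  have hlog : Real.log (p * q / j) ≤ p * q / j - 1 := Real.log_le_sub_one_of_pos (by positivity)
  rw [Real.log_div (by positivity) hj.ne', Real.log_mul hp.ne' hq.ne'] at hlog
  rw [Real.log_div hj.ne' (by positivity), Real.log_mul hp.ne' hr.ne']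
  have hmul := mul_le_mul_of_nonneg_left hlog hj.le
  have hmul' := mul_le_mul_of_nonneg_left hlogr hj.le
  have hcancel : j * (p * q / j - 1) = p * q - j := by field_simp
  have hnum : j * (-Real.log M) + j * Real.log q + (j - p * q) ≤
      j * (Real.log j - (Real.log p + Real.log r)) := by linarith
  have := div_le_div_of_nonneg_right hnum hlog2.le
  calc _ = (j * (-Real.log M) + j * Real.log q + (j - p * q)) / Real.log 2 := by ring
    _ ≤ _ := this
    _ = _ := by ring

/-- Deterministically, `Î₂(x; x ⊕ e) ≥ -log₂ M - h_b(ε̂)` when `M` bounds the marginal of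
`x ⊕ e`. -/
theorem empMI2_xor_ge {n : ℕ} (hn : 0 < n) (x e : Fin n → Bool) {M : ℝ}
    (hM : ∀ b, empMarg2 n (fun i => xor (x i) (e i)) b ≤ M) :
    -Real.logb 2 M - binEnt (empMarg2 n e true) ≤
      empMI2 n x (fun i => xor (x i) (e i)) := by
  set y : Fin n → Bool := fun i => xor (x i) (e i) with hy
  have key (a b : Bool) := mul_logb_div_ge (j := empJoint2 n x y a b)
    (by unfold empJoint2; positivity)
    (empJoint2_le_empMarg2_left n x y a b) (empJoint2_le_empMarg2_right n x y a b)
    (empJoint2_le_empMarg2_xor n x e a b) (hM b)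
  refine le_trans (le_of_eq ?_)
    (Finset.sum_le_sum fun a _ => Finset.sum_le_sum fun b _ => key a b)
  have hxt := empJoint2_add_eq_empMarg2_left n x y true
  have hxf := empJoint2_add_eq_empMarg2_left n x y false
  have het := empJoint2_add_eq_empMarg2_xor n x e true
  have hef := empJoint2_add_eq_empMarg2_xor n x e false
  have hx := empMarg2_true_add_false hn x
  have he := empMarg2_true_add_false hn e
  rw [← hy] at het hef
  simp only [Fintype.sum_bool, Bool.xor_true, Bool.xor_false, Bool.not_true, Bool.not_false,
    binEnt] at *
  rw [show 1 - empMarg2 n e true = empMarg2 n e false by linarith]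
  have hsum : empJoint2 n x y true true + empJoint2 n x y true false +
      empJoint2 n x y false true + empJoint2 n x y false false = 1 := by linarith
  have hprod : (empMarg2 n x true + empMarg2 n x false) *
    (empMarg2 n e true + empMarg2 n e false) = 1 := by rw [hx, he, one_mul]
  linear_combination (Real.logb 2 M - 1 / Real.log 2) * hsum + hprod / Real.log 2 -
    Real.logb 2 (empMarg2 n e true) * het - Real.logb 2 (empMarg2 n e false) * hef

theorem memLp_bool {p : ENNReal} {μ : Measure Bool} [IsFiniteMeasure μ] (f : Bool → ℝ) :
    MemLp f p μ :=
  .of_bound (measurable_of_finite f).aestronglyMeasurable (max ‖f true‖ ‖f false‖)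
    (.of_forall fun b => by cases b <;> simp)

theorem integral_uniform_bool (f : Bool → ℝ) :
    ∫ b, f b ∂(PMF.uniformOfFintype Bool).toMeasure = (f true + f false) / 2 := by
  rw [PMF.integral_eq_sum]
  simp
  ring

theorem variance_sign_xor_uniform (c : Bool) :
    ProbabilityTheory.variance (fun b => if xor b c then (1 : ℝ) else -1)
      (PMF.uniformOfFintype Bool).toMeasure = 1 := by
  rw [ProbabilityTheory.variance_eq_integral (measurable_of_finite _).aemeasurable]
  simp only [integral_uniform_bool]
  cases c <;> norm_num

/-- The number of ones minus the number of zeros of `x ⊕ e`. -/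
noncomputable def signSumXor {n : ℕ} (e x : Fin n → Bool) : ℝ :=
  ∑ i, if xor (x i) (e i) then (1 : ℝ) else -1

theorem measure_le_abs_signSumXor {n : ℕ} (e : Fin n → Bool) {c : ℝ} (hc : 0 < c) :
    (Measure.pi fun _ : Fin n => (PMF.uniformOfFintype Bool).toMeasure)
      {x | c ≤ |signSumXor e x|} ≤ ENNReal.ofReal (n / c ^ 2) := by
  set μ := Measure.pi fun _ : Fin n => (PMF.uniformOfFintype Bool).toMeasure with hμ
  have hfun : signSumXor e =
      ∑ i, fun x : Fin n → Bool => if xor (x i) (e i) then (1 : ℝ) else -1 := by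
    ext x
    simp [signSumXor]
  have hLp (i : Fin n) :
      MemLp (fun x : Fin n → Bool => if xor (x i) (e i) then (1 : ℝ) else -1) 2 μ :=
    (memLp_bool fun b => if xor b (e i) then (1 : ℝ) else -1).comp_measurePreserving
      (measurePreserving_eval _ i)
  have hvar : ProbabilityTheory.variance (signSumXor e) μ = n := by
    rw [hfun, ProbabilityTheory.variance_sum_pi
      (X := fun i b => if xor b (e i) then (1 : ℝ) else -1) fun i => memLp_bool _]
    simp only [variance_sign_xor_uniform]
    simp
  have hmean : ∫ x, signSumXor e x ∂μ = 0 := by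
    unfold signSumXor
    rw [integral_finsetSum _ fun i _ => (hLp i).integrable one_le_two]
    refine Finset.sum_eq_zero fun i _ => ?_
    rw [hμ, integral_comp_eval (μ := fun _ : Fin n => (PMF.uniformOfFintype Bool).toMeasure)
      (f := fun b => if xor b (e i) then (1 : ℝ) else -1)
      (measurable_of_finite _).aestronglyMeasurable, integral_uniform_bool]
    cases e i <;> norm_num
  have hS : MemLp (signSumXor e) 2 μ := by
    rw [hfun]
    exact memLp_finsetSum' _ fun i _ => hLp i
  simpa [hmean, hvar] using ProbabilityTheory.meas_ge_le_variance_div_sq hS hc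

theorem empMarg2_true_sub_false (n : ℕ) (e x : Fin n → Bool) :
    empMarg2 n (fun i => xor (x i) (e i)) true - empMarg2 n (fun i => xor (x i) (e i)) false =
      signSumXor e x / n := by
  unfold empMarg2 signSumXor
  rw [← sub_div, Finset.card_filter, Finset.card_filter]
  push_cast
  rw [← Finset.sum_sub_distrib]
  congr 1
  refine Finset.sum_congr rfl fun i _ => ?_
  cases x i <;> cases e i <;> simp

theorem empMarg2_xor_le {n : ℕ} (hn : 0 < n) {e x : Fin n → Bool} {M : ℝ}
    (h : |signSumXor e x| ≤ (2 * M - 1) * n) (b : Bool) :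
    empMarg2 n (fun i => xor (x i) (e i)) b ≤ M := by
  have hn' : (0 : ℝ) < n := by exact_mod_cast hn
  have hadd := empMarg2_true_add_false hn fun i => xor (x i) (e i)
  have hsub := empMarg2_true_sub_false n e x
  have habs : |signSumXor e x / n| ≤ 2 * M - 1 := by
    rwa [abs_div, abs_of_pos hn', div_le_iff₀ hn']
  obtain ⟨h₁, h₂⟩ := abs_le.1 habs
  cases b <;> linarith

/-- Uniformly over all error sequences `e`: if `X` is i.i.d. `Bernoulli(1/2)` then with
probability at least `1 − ε`, `Î₂(X; X ⊕ e) ≥ 1 − h_b(ε̂) − δ`, where `ε̂` is the fraction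
of ones in `e`. -/
theorem empMI_binary_individual_noise (δ ε : ℝ) (hδ : 0 < δ) (hε : 0 < ε) :
    ∃ n₀ : ℕ, ∀ n, n₀ ≤ n → ∀ e : Fin n → Bool,
      (Measure.pi fun _ : Fin n => (PMF.uniformOfFintype Bool).toMeasure)
          {x : Fin n → Bool |
            empMI2 n x (fun i => xor (x i) (e i)) <
              1 - binEnt (((Finset.univ.filter fun i => e i = true).card : ℝ) / n) - δ}
        ≤ ENNReal.ofReal ε := by
  set M : ℝ := 2 ^ (δ - 1)
  have hM : 0 < 2 * M - 1 := by
    have : (2 : ℝ) ^ (-1 : ℝ) < M := Real.rpow_lt_rpow_of_exponent_lt one_lt_two (by linarith)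
    rw [Real.rpow_neg_one] at this
    linarith
  have hlogM : Real.logb 2 M = δ - 1 := Real.logb_rpow two_pos (by norm_num)
  obtain ⟨n₀, hn₀⟩ := exists_nat_ge (1 / ((2 * M - 1) ^ 2 * ε))
  refine ⟨n₀ + 1, fun n hn e => ?_⟩
  have hnpos : 0 < n := by omega
  have hn' : (0 : ℝ) < n := by exact_mod_cast hnpos
  refine (measure_mono fun x hx => ?_).trans
    ((measure_le_abs_signSumXor e (mul_pos hM hn')).trans (ENNReal.ofReal_le_ofReal ?_))
  · by_contra hlt
    have hlower := empMI2_xor_ge hnpos x e (empMarg2_xor_le hnpos (not_le.1 hlt).le)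
    rw [hlogM] at hlower
    have hx' : empMI2 n x (fun i => xor (x i) (e i)) < 1 - binEnt (empMarg2 n e true) - δ := hx
    linarith
  · have hle : (n₀ : ℝ) ≤ n := by exact_mod_cast (by omega : n₀ ≤ n)
    have hbig := hn₀.trans hle
    rw [div_le_iff₀ (by positivity)] at hbig
    rw [div_le_iff₀ (by positivity)]
    calc (n : ℝ) = n * 1 := (mul_one _).symm
      _ ≤ n * (n * ((2 * M - 1) ^ 2 * ε)) := by gcongr
      _ = ε * ((2 * M - 1) * n) ^ 2 := by ring
end
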